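/- Let X be a C*-correspondence over A and I a positively invariant ideal. Let Y_I = φ_X(I)X, viewed as a C*-correspondence over I. Then ker φ_{Y_I} = I ∩ ker φ_X, φ_{Y_I}⁻¹(K(Y_I)) = I ∩ φ_X⁻¹(K(X)), and J_{Y_I} = I ∩ J_X. -/

import Mathlib

noncomputable section

/-- A (right) Hilbert C*-module over a C*-algebra `A`. -/
class HilbertModule (A : Type*) [CStarAlgebra A] (X : Type*)
    [NormedAddCommGroup X] [NormedSpace ℂ X] : Type _ where
  rsmul : X → A → X
  inner : X → X → A
  rsmul_add_left : ∀ (x y : X) (a : A), rsmul (x + y) a = rsmul x a + rsmul y a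
  rsmul_add_right : ∀ (x : X) (a b : A), rsmul x (a + b) = rsmul x a + rsmul x b
  rsmul_rsmul : ∀ (x : X) (a b : A), rsmul (rsmul x a) b = rsmul x (a * b)
  rsmul_csmul_left : ∀ (c : ℂ) (x : X) (a : A), rsmul (c • x) a = c • rsmul x a
  rsmul_csmul_right : ∀ (c : ℂ) (x : X) (a : A), rsmul x (c • a) = c • rsmul x a
  inner_add_left : ∀ (x y z : X), inner (x + y) z = inner x z + inner y z
  inner_add_right : ∀ (x y z : X), inner x (y + z) = inner x y + inner x z
  inner_csmul_right : ∀ (c : ℂ) (x y : X), inner x (c • y) = c • inner x y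
  star_inner : ∀ (x y : X), star (inner x y) = inner y x
  inner_rsmul_right : ∀ (x y : X) (a : A), inner x (rsmul y a) = inner x y * a
  inner_self_isPositive : ∀ x : X, ∃ b : A, inner x x = star b * b
  norm_sq_inner : ∀ x : X, ‖x‖ ^ 2 = ‖inner x x‖
  norm_inner_le : ∀ x y : X, ‖inner x y‖ ≤ ‖x‖ * ‖y‖
  norm_rsmul_le : ∀ (x : X) (a : A), ‖rsmul x a‖ ≤ ‖x‖ * ‖a‖

namespace HilbertModule

variable {A : Type*} [CStarAlgebra A] {X : Type*}
  [NormedAddCommGroup X] [NormedSpace ℂ X] [HilbertModule A X]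

/-- The closed submodule `X·S` generated by products `ξ·a`, `a ∈ S`. -/
def idealSub (X : Type*) {A : Type*} [CStarAlgebra A] [NormedAddCommGroup X]
    [NormedSpace ℂ X] [HilbertModule A X] (S : Set A) : Set X :=
  closure (Submodule.span ℂ {x : X | ∃ (ξ : X) (a : A), a ∈ S ∧ x = rsmul ξ a} : Set X)

/-- The rank-one ("theta") operator `ζ ↦ ξ⟨η,ζ⟩`. -/
def rankOne (A : Type*) {X : Type*} [CStarAlgebra A] [NormedAddCommGroup X]
    [NormedSpace ℂ X] [HilbertModule A X] (ξ η : X) : X →L[ℂ] X :=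
  LinearMap.mkContinuous
    { toFun := fun ζ => rsmul ξ (inner (A := A) η ζ)
      map_add' := fun x y => by
        show rsmul ξ (inner (A := A) η (x + y)) = _
        rw [inner_add_right, rsmul_add_right]
      map_smul' := fun c x => by
        show rsmul ξ (inner (A := A) η (c • x)) = _
        simp only [RingHom.id_apply]
        rw [inner_csmul_right, rsmul_csmul_right] }
    (‖ξ‖ * ‖η‖)
    (fun ζ => by
      calc ‖rsmul ξ (inner (A := A) η ζ)‖ ≤ ‖ξ‖ * ‖inner (A := A) η ζ‖ :=
            norm_rsmul_le _ _
        _ ≤ ‖ξ‖ * (‖η‖ * ‖ζ‖) :=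
            mul_le_mul_of_nonneg_left (norm_inner_le _ _) (norm_nonneg _)
        _ = ‖ξ‖ * ‖η‖ * ‖ζ‖ := (mul_assoc _ _ _).symm)

/-- The set of "compact" operators `K(X)`: the closed linear span of rank-one operators. -/
def compacts (A X : Type*) [CStarAlgebra A] [NormedAddCommGroup X]
    [NormedSpace ℂ X] [HilbertModule A X] : Set (X →L[ℂ] X) :=
  closure (Submodule.span ℂ {T : X →L[ℂ] X | ∃ ξ η : X, T = rankOne A ξ η} : Set (X →L[ℂ] X))

/-- `K(X·I)`, viewed inside the operators on `X`: the closed span of rank-one operators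
with both legs in the subset `S`. -/
def compactsOn (A : Type*) {X : Type*} [CStarAlgebra A] [NormedAddCommGroup X]
    [NormedSpace ℂ X] [HilbertModule A X] (S : Set X) : Set (X →L[ℂ] X) :=
  closure (Submodule.span ℂ
    {T : X →L[ℂ] X | ∃ ξ ∈ S, ∃ η ∈ S, T = rankOne A ξ η} : Set (X →L[ℂ] X))

/-- An operator is adjointable if it has an adjoint with respect to the `A`-valued
inner product. -/
def IsAdjointable (A : Type*) {X : Type*} [CStarAlgebra A] [NormedAddCommGroup X]
    [NormedSpace ℂ X] [HilbertModule A X] (S : X →L[ℂ] X) : Prop :=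
  ∃ T : X →L[ℂ] X, ∀ x y : X, inner (A := A) (S x) y = inner (A := A) x (T y)

end HilbertModule

/-- A C*-correspondence over `A`: a Hilbert `A`-module with a left action of `A`
by adjointable operators. -/
class Correspondence (A : Type*) [CStarAlgebra A] (X : Type*)
    [NormedAddCommGroup X] [NormedSpace ℂ X] extends HilbertModule A X where
  lsmul : A → X → X
  lsmul_add_left : ∀ (a b : A) (x : X), lsmul (a + b) x = lsmul a x + lsmul b x
  lsmul_add_right : ∀ (a : A) (x y : X), lsmul a (x + y) = lsmul a x + lsmul a y
  lsmul_mul : ∀ (a b : A) (x : X), lsmul (a * b) x = lsmul a (lsmul b x)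
  lsmul_csmul_left : ∀ (c : ℂ) (a : A) (x : X), lsmul (c • a) x = c • lsmul a x
  lsmul_csmul_right : ∀ (c : ℂ) (a : A) (x : X), lsmul a (c • x) = c • lsmul a x
  inner_lsmul_left : ∀ (a : A) (x y : X), inner (lsmul a x) y = inner x (lsmul (star a) y)
  lsmul_rsmul : ∀ (a : A) (x : X) (b : A), lsmul a (rsmul x b) = rsmul (lsmul a x) b
  norm_lsmul_le : ∀ (a : A) (x : X), ‖lsmul a x‖ ≤ ‖a‖ * ‖x‖

namespace Correspondence

open HilbertModule

variable {A : Type*} [CStarAlgebra A] {X : Type*}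
  [NormedAddCommGroup X] [NormedSpace ℂ X] [Correspondence A X]

/-- The left action `φ_X(a)` as a continuous linear operator on `X`. -/
def lact (A : Type*) {X : Type*} [CStarAlgebra A] [NormedAddCommGroup X]
    [NormedSpace ℂ X] [Correspondence A X] (a : A) : X →L[ℂ] X :=
  LinearMap.mkContinuous
    { toFun := lsmul a
      map_add' := lsmul_add_right a
      map_smul' := fun c x => by
        show lsmul a (c • x) = _
        simp only [RingHom.id_apply]; rw [lsmul_csmul_right] }
    ‖a‖ (norm_lsmul_le a)

/-- The ideal `X(S)`: closed span of `{⟨η, φ_X(a)ξ⟩ : a ∈ S}`. -/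
def corrApply (X : Type*) {A : Type*} [CStarAlgebra A] [NormedAddCommGroup X]
    [NormedSpace ℂ X] [Correspondence A X] (S : Set A) : Set A :=
  closure (Submodule.span ℂ
    {b : A | ∃ a ∈ S, ∃ ξ η : X, b = inner (A := A) η (lsmul a ξ)} : Set A)

/-- The ideal `X⁻¹(S) = {a : ⟨η, φ_X(a)ξ⟩ ∈ S for all ξ, η}`. -/
def corrInv (X : Type*) {A : Type*} [CStarAlgebra A] [NormedAddCommGroup X]
    [NormedSpace ℂ X] [Correspondence A X] (S : Set A) : Set A :=
  {a : A | ∀ ξ η : X, inner (A := A) η (lsmul a ξ) ∈ S}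

/-- The kernel of the left action `φ_X`. -/
def kerLact (X : Type*) {A : Type*} [CStarAlgebra A] [NormedAddCommGroup X]
    [NormedSpace ℂ X] [Correspondence A X] : Set A :=
  {a : A | ∀ ξ : X, lsmul a ξ = 0}

/-- Katsura's ideal `J_X = φ_X⁻¹(K(X)) ∩ (ker φ_X)^⊥`. -/
def JX (X : Type*) {A : Type*} [CStarAlgebra A] [NormedAddCommGroup X]
    [NormedSpace ℂ X] [Correspondence A X] : Set A :=
  {a : A | lact A (X := X) a ∈ compacts A X ∧ ∀ b ∈ kerLact X, a * b = 0}

end Correspondence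

open HilbertModule Correspondence

/-- Data presenting a Hilbert `B`-module `Y` as the quotient `X_I = X/XI` of a Hilbert
`A`-module `X` by a closed two-sided ideal `I` of `A` (with `B` playing the role of `A/I`). -/
structure QuotientData (A B : Type*) [CStarAlgebra A] [CStarAlgebra B]
    (I : TwoSidedIdeal A)
    (X Y : Type*) [NormedAddCommGroup X] [NormedSpace ℂ X] [HilbertModule A X]
    [NormedAddCommGroup Y] [NormedSpace ℂ Y] [HilbertModule B Y] : Type _ where
  π : A →⋆ₐ[ℂ] B
  π_surjective : Function.Surjective π
  π_ker : ∀ a : A, π a = 0 ↔ a ∈ I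
  q : X →ₗ[ℂ] Y
  q_surjective : Function.Surjective q
  q_ker : ∀ ξ : X, q ξ = 0 ↔ ξ ∈ idealSub X (I : Set A)
  q_inner : ∀ ξ ζ : X, inner (A := B) (q ξ) (q ζ) = π (inner (A := A) ξ ζ)
  q_rsmul : ∀ (ξ : X) (a : A), q (rsmul ξ a) = rsmul (q ξ) (π a)


/-- Quotient data compatible with the left actions (presenting `X_I` as a
C*-correspondence over `A/I`). -/
structure CorrQuotientData (A B : Type*) [CStarAlgebra A] [CStarAlgebra B]
    (I : TwoSidedIdeal A)
    (X Y : Type*) [NormedAddCommGroup X] [NormedSpace ℂ X] [Correspondence A X]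
    [NormedAddCommGroup Y] [NormedSpace ℂ Y] [Correspondence B Y]
    extends QuotientData A B I X Y where
  q_lsmul : ∀ (a : A) (ξ : X), q (lsmul a ξ) = lsmul (π a) (q ξ)

/-- Katsura's ideal `J(I) = {a : [φ_X(a)]_I ∈ K(X_I), a·X⁻¹(I) ⊂ I}`, expressed via
quotient data presenting `X_I`. -/
def JofI {A B : Type*} [CStarAlgebra A] [CStarAlgebra B] {I : TwoSidedIdeal A}
    {X Y : Type*} [NormedAddCommGroup X] [NormedSpace ℂ X] [Correspondence A X]
    [NormedAddCommGroup Y] [NormedSpace ℂ Y] [HilbertModule B Y]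
    (D : QuotientData A B I X Y) : Set A :=
  {a : A | (∃ T ∈ compacts B Y, ∀ ξ : X, T (D.q ξ) = D.q (lsmul a ξ)) ∧
    ∀ b ∈ corrInv X (I : Set A), a * b ∈ I}

/-- A Hilbert `A`-bimodule: a C*-correspondence together with a left inner product
satisfying `φ_X(⟪ξ,η⟫) = θ_{ξ,η}`. -/
class HilbertBimodule (A : Type*) [CStarAlgebra A] (X : Type*)
    [NormedAddCommGroup X] [NormedSpace ℂ X] extends Correspondence A X where
  linner : X → X → A
  lsmul_linner : ∀ ξ η ζ : X, lsmul (linner ξ η) ζ = rsmul ξ (inner η ζ)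

/-- The closed subspace `φ_X(S)X`: closed span of `{φ_X(a)ξ : a ∈ S}`. -/
def lsmulSet (X : Type*) {A : Type*} [CStarAlgebra A] [NormedAddCommGroup X]
    [NormedSpace ℂ X] [Correspondence A X] (S : Set A) : Set X :=
  closure (Submodule.span ℂ
    {x : X | ∃ a ∈ S, ∃ ξ : X, x = Correspondence.lsmul a ξ} : Set X)

theorem aux_approx {A : Type*} [CStarAlgebra A] (a : A) {ε : ℝ} (hε : 0 < ε) :
    ∃ c : A, star (star a * a * c) = star a * a * c ∧ ‖a - a * (star a * a * c)‖ ^ 2 ≤ ε := by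
  have hp : IsSelfAdjoint (star a * a) := IsSelfAdjoint.star_mul_self a
  set p := star a * a with hpdef
  have hden : ∀ t : ℝ, 0 < ε ^ 2 + t ^ 2 := fun t => by positivity
  have hc1 : Continuous (fun t : ℝ => t / (ε ^ 2 + t ^ 2)) :=
    continuous_id.div (by fun_prop) (fun t => (hden t).ne')
  have hc2 : Continuous (fun t : ℝ => ε ^ 2 / (ε ^ 2 + t ^ 2)) :=
    continuous_const.div (by fun_prop) (fun t => (hden t).ne')
  set w := cfc (fun t : ℝ => ε ^ 2 / (ε ^ 2 + t ^ 2)) p with hw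
  have hwsa : star w = w := (cfc_predicate _ p : IsSelfAdjoint w)
  have hv : p * cfc (fun t : ℝ => t / (ε ^ 2 + t ^ 2)) p = 1 - w := by
    conv_lhs => rw [← cfc_id ℝ p, cfc_id ℝ p]
    have h1 : p * cfc (fun t : ℝ => t / (ε ^ 2 + t ^ 2)) p
        = cfc (fun t : ℝ => t * (t / (ε ^ 2 + t ^ 2))) p := by
      rw [cfc_mul (fun t : ℝ => t) _ p (by fun_prop) hc1.continuousOn, cfc_id' ℝ p]
    rw [h1, hw, ← cfc_one ℝ p, ← cfc_sub _ _ p (by fun_prop) hc2.continuousOn]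
    congr 1
    ext t
    have := (hden t).ne'
    simp only [Pi.one_apply]
    field_simp
    ring
  refine ⟨cfc (fun t : ℝ => t / (ε ^ 2 + t ^ 2)) p, ?_, ?_⟩
  · rw [hv, star_sub, star_one, hwsa]
  · rw [hv]
    have h2 : a - a * (1 - w) = a * w := by noncomm_ring
    rw [h2, sq, ← CStarRing.norm_star_mul_self, star_mul, hwsa]
    have h3 : w * star a * (a * w) = cfc (fun t : ℝ => ε ^ 2 / (ε ^ 2 + t ^ 2) *
        (t * (ε ^ 2 / (ε ^ 2 + t ^ 2)))) p := by
      rw [cfc_mul (fun t : ℝ => ε ^ 2 / (ε ^ 2 + t ^ 2)) (fun t : ℝ => t * (ε ^ 2 / (ε ^ 2 + t ^ 2))) p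
        hc2.continuousOn (continuous_id.mul hc2).continuousOn,
        cfc_mul (fun t : ℝ => t) _ p (by fun_prop) hc2.continuousOn, cfc_id' ℝ p, ← hw, hpdef]
      noncomm_ring
    rw [h3]
    refine norm_cfc_le hε.le fun t _ => ?_
    have hd := hden t
    have hg1 : ε ^ 2 / (ε ^ 2 + t ^ 2) ≤ 1 := by
      rw [div_le_one hd]; nlinarith [sq_nonneg t]
    have hg0 : 0 ≤ ε ^ 2 / (ε ^ 2 + t ^ 2) := by positivity
    rw [norm_mul, norm_mul, Real.norm_of_nonneg hg0, Real.norm_eq_abs]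
    have hb : |t| * (ε ^ 2 / (ε ^ 2 + t ^ 2)) ≤ ε := by
      rw [← mul_div_assoc, div_le_iff₀ hd]
      nlinarith [sq_nonneg (|t| - ε), sq_abs t, abs_nonneg t, mul_nonneg hε.le (sq_nonneg (|t| - ε)),
        pow_pos hε 3, mul_nonneg hε.le (sq_nonneg t)]
    calc _ ≤ 1 * ε := mul_le_mul hg1 hb (by positivity) zero_le_one
      _ = ε := one_mul _

theorem aux_right {A : Type*} [CStarAlgebra A] (I : TwoSidedIdeal A) {a : A} (ha : a ∈ I) :
    a ∈ closure {x : A | ∃ v ∈ I, star v = v ∧ x = a * v} := by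
  rw [Metric.mem_closure_iff]
  intro ε hε
  obtain ⟨c, h1, h2⟩ := aux_approx a (ε := (ε / 2) ^ 2) (by positivity)
  refine ⟨_, ⟨_, I.mul_mem_right _ _ (I.mul_mem_left _ _ ha), h1, rfl⟩, ?_⟩
  rw [dist_eq_norm]
  have := (sq_le_sq₀ (norm_nonneg _) (by positivity)).1 h2
  linarith

theorem aux_left {A : Type*} [CStarAlgebra A] (I : TwoSidedIdeal A) {a : A} (ha : a ∈ I) :
    a ∈ closure {x : A | ∃ v ∈ I, x = v * a} := by
  rw [Metric.mem_closure_iff]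
  intro ε hε
  obtain ⟨c, h1, h2⟩ := aux_approx (star a) (ε := (ε / 2) ^ 2) (by positivity)
  rw [star_star] at h1 h2
  refine ⟨_, ⟨a * star a * c, I.mul_mem_right _ _ (I.mul_mem_right _ _ ha), rfl⟩, ?_⟩
  rw [dist_eq_norm]
  have := (sq_le_sq₀ (norm_nonneg _) (by positivity)).1 h2
  rw [← norm_star, star_sub, star_star, star_mul, star_star, h1] at this
  linarith

section
variable {A : Type*} [CStarAlgebra A] {X : Type*} [NormedAddCommGroup X]
    [NormedSpace ℂ X] [Correspondence A X]

theorem aux_inner_self {x : X} (h : HilbertModule.inner (A := A) x x = 0) : x = 0 := by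
  have := norm_sq_inner (A := A) x
  rw [h, norm_zero] at this
  simpa using this

theorem aux_lact_apply (a : A) (x : X) : lact A a x = lsmul a x := rfl

theorem aux_rankOne_apply (ξ η x : X) :
    rankOne A ξ η x = rsmul ξ (HilbertModule.inner (A := A) η x) := rfl

theorem aux_lsmul_zero (a : A) : lsmul a (0 : X) = 0 := (lact A (X := X) a).map_zero

theorem aux_inner_zero (x : X) : HilbertModule.inner (A := A) x 0 = 0 := by
  have := inner_csmul_right (A := A) 0 x 0
  simpa using this

theorem aux_inner_lsmul_right (a : A) (x y : X) :
    HilbertModule.inner (A := A) x (lsmul a y) = HilbertModule.inner (A := A) (lsmul (star a) x) y := by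
  rw [inner_lsmul_left, star_star]

theorem aux_star_mul {a : A} {x : X} (h : lsmul (star a * a) x = 0) : lsmul a x = 0 := by
  apply aux_inner_self (A := A)
  rw [inner_lsmul_left, ← lsmul_mul, h, aux_inner_zero]

theorem aux_ker {a : A} {x : X} (h : lsmul (a * (star a * a)) x = 0) : lsmul a x = 0 := by
  apply aux_star_mul
  apply aux_star_mul
  rw [star_mul, star_star, mul_assoc, lsmul_mul, h, aux_lsmul_zero]

theorem aux_lact_cont : Continuous (fun a : A => lact A (X := X) a) := by
  let L : A →ₗ[ℂ] (X →L[ℂ] X) :=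
    { toFun := fun a => lact A a
      map_add' := fun a b => by ext x; exact lsmul_add_left a b x
      map_smul' := fun c a => by ext x; exact lsmul_csmul_left c a x }
  exact (L.mkContinuous 1 (fun a => by
    rw [one_mul]
    exact LinearMap.mkContinuous_norm_le _ (norm_nonneg _) (norm_lsmul_le a))).continuous

theorem aux_lact_mul (a b : A) : lact A (X := X) (a * b) = (lact A a).comp (lact A b) := by
  ext x; exact lsmul_mul a b x

theorem aux_lact_rankOne (a : A) (ξ η : X) :
    (lact A a).comp (rankOne A ξ η) = rankOne A (lsmul a ξ) η := by
  ext x; exact lsmul_rsmul a ξ _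

theorem aux_rankOne_lact (a : A) (ξ η : X) :
    (rankOne A ξ η).comp (lact A a) = rankOne A ξ (lsmul (star a) η) := by
  ext x
  show rsmul ξ (HilbertModule.inner (A := A) η (lsmul a x)) = rsmul ξ _
  rw [ aux_inner_lsmul_right]

theorem aux_closure_span {E F : Type*} [NormedAddCommGroup E] [NormedSpace ℂ E]
    [NormedAddCommGroup F] [NormedSpace ℂ F] (L : E →L[ℂ] F) {s : Set E} {t : Set F}
    (h : ∀ x ∈ s, L x ∈ t) {x : E} (hx : x ∈ closure (Submodule.span ℂ s : Set E)) :
    L x ∈ closure (Submodule.span ℂ t : Set F) := by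
  refine map_mem_closure L.continuous hx fun y hy => ?_
  have : Submodule.span ℂ s ≤ (Submodule.span ℂ t).comap (L : E →ₗ[ℂ] F) :=
    Submodule.span_le.2 fun z hz => Submodule.subset_span (h z hz)
  exact this hy

theorem aux_mem_Y (I : TwoSidedIdeal A) {a : A} (ha : a ∈ I) (x : X) :
    lsmul a x ∈ lsmulSet X (I : Set A) :=
  subset_closure (Submodule.subset_span ⟨a, ha, x, rfl⟩)

theorem aux_part1 (I : TwoSidedIdeal A) (a : A) (ha : a ∈ I) :
    (∀ y ∈ lsmulSet X (I : Set A), lsmul a y = 0) ↔ a ∈ kerLact (A := A) X := by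
  constructor
  · intro h x
    apply aux_ker
    rw [lsmul_mul]
    exact h _ (aux_mem_Y I (I.mul_mem_left _ _ ha) x)
  · intro h y _
    exact h y

theorem aux_part2 (I : TwoSidedIdeal A) (a : A) (ha : a ∈ I) :
    (∃ k ∈ compactsOn A (lsmulSet X (I : Set A)),
      ∀ y ∈ lsmulSet X (I : Set A), k y = lsmul a y) ↔ lact A (X := X) a ∈ compacts A X := by
  constructor
  · rintro ⟨k, hk, h⟩
    have hcl : IsClosed (compacts A X) := isClosed_closure
    rw [← hcl.closure_eq]
    refine map_mem_closure aux_lact_cont (aux_right I ha) ?_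
    rintro _ ⟨v, hv, -, rfl⟩
    have : lact A (X := X) (a * v) = k.comp (lact A v) := by
      ext x
      rw [aux_lact_mul]
      exact (h _ (aux_mem_Y I hv x)).symm
    rw [this]
    refine aux_closure_span ((ContinuousLinearMap.compL ℂ X X X).flip (lact A v)) ?_ hk
    rintro _ ⟨ξ, _, η, _, rfl⟩
    exact ⟨_, _, aux_rankOne_lact v ξ η⟩
  · intro h
    refine ⟨lact A a, ?_, fun y _ => rfl⟩
    have hcl : IsClosed (compactsOn A (lsmulSet X (I : Set A))) := isClosed_closure
    rw [← hcl.closure_eq]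
    refine map_mem_closure aux_lact_cont (aux_right I ha) ?_
    rintro _ ⟨v, hv, hvs, rfl⟩
    rw [← hcl.closure_eq]
    refine map_mem_closure (f := fun b : A => lact A (X := X) (b * v))
      (aux_lact_cont.comp (continuous_mul_const v)) (aux_left I ha) ?_
    rintro _ ⟨u, hu, rfl⟩
    show lact A (u * a * v) ∈ _
    rw [aux_lact_mul, aux_lact_mul]
    refine aux_closure_span (((ContinuousLinearMap.compL ℂ X X X).flip (lact A v)).comp
      (ContinuousLinearMap.compL ℂ X X X (lact A u))) ?_ h
    rintro _ ⟨ξ, η, rfl⟩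
    refine ⟨lsmul u ξ, aux_mem_Y I hu ξ, lsmul v η, aux_mem_Y I hv η, ?_⟩
    show ((lact A u).comp (rankOne A ξ η)).comp (lact A v) = _
    rw [aux_lact_rankOne, aux_rankOne_lact, hvs]

theorem aux_part3 (I : TwoSidedIdeal A) (a : A) (ha : a ∈ I)
    (h : ∀ b : A, b ∈ I → b ∈ kerLact (A := A) X → a * b = 0) (b : A)
    (hb : b ∈ kerLact (A := A) X) : a * b = 0 := by
  have h1 := h (b * star b * star a * a) (I.mul_mem_left _ _ ha) ?_
  · have h2 : star (star (a * b) * (a * b)) * (star (a * b) * (a * b)) = 0 := by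
      calc _ = star (a * b) * (a * (b * star b * star a * a)) * b := by
            simp only [star_mul, star_star]; noncomm_ring
        _ = 0 := by rw [h1]; simp
    rwa [CStarRing.star_mul_self_eq_zero_iff, CStarRing.star_mul_self_eq_zero_iff] at h2
  · intro x
    rw [mul_assoc, mul_assoc, lsmul_mul]
    exact hb _

end

open HilbertModule Correspondence in
/-- for a positively invariant ideal `I` and the C*-correspondence
`Y_I = φ_X(I)X` over `I`:
`ker φ_{Y_I} = I ∩ ker φ_X`, `φ_{Y_I}⁻¹(K(Y_I)) = I ∩ φ_X⁻¹(K(X))`, and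
`J_{Y_I} = I ∩ J_X`. -/
theorem stmt18 {A : Type*} [CStarAlgebra A] {X : Type*} [NormedAddCommGroup X]
    [NormedSpace ℂ X] [Correspondence A X] [CompleteSpace X]
    (I : TwoSidedIdeal A) (hI : IsClosed (I : Set A))
    (hpos : corrApply X (I : Set A) ⊆ (I : Set A)) :
    -- `ker φ_{Y_I} = I ∩ ker φ_X`:
    {a : A | a ∈ I ∧ ∀ y ∈ lsmulSet X (I : Set A), lsmul a y = 0} =
      (I : Set A) ∩ kerLact X ∧
    -- `φ_{Y_I}⁻¹(K(Y_I)) = I ∩ φ_X⁻¹(K(X))`: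
    {a : A | a ∈ I ∧ ∃ k ∈ compactsOn A (lsmulSet X (I : Set A)),
        ∀ y ∈ lsmulSet X (I : Set A), k y = lsmul a y} =
      (I : Set A) ∩ {a : A | lact A (X := X) a ∈ compacts A X} ∧
    -- `J_{Y_I} = I ∩ J_X`:
    {a : A | a ∈ I ∧ (∃ k ∈ compactsOn A (lsmulSet X (I : Set A)),
          ∀ y ∈ lsmulSet X (I : Set A), k y = lsmul a y) ∧
        ∀ b : A, (b ∈ I ∧ ∀ y ∈ lsmulSet X (I : Set A), lsmul b y = 0) → a * b = 0} =
      (I : Set A) ∩ JX X := by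
  refine ⟨?_, ?_, ?_⟩
  · ext a
    exact and_congr_right fun ha => aux_part1 I a ha
  · ext a
    exact and_congr_right fun ha => aux_part2 I a ha
  · ext a
    refine and_congr_right fun ha => and_congr (aux_part2 I a ha) ⟨fun h b hb => ?_, fun h b hb => ?_⟩
    · exact aux_part3 (X := X) I a ha (fun c hc hk => h c ⟨hc, (aux_part1 I c hc).2 hk⟩) b hb
    · exact h b ((aux_part1 I b hb.1).1 hb.2)
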